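/- Soundness of the nominal anti-unification algorithm 𝔑: Let t and s be nominal terms of the same sort and ∇ a freshness context, all based on a finite set of atoms A. If {X : t ≜ s}; ∅; ∅; ε ⟹⁺ ∅; S; Γ; σ is a derivation obtained by an execution of 𝔑 (with global parameters A and ∇), then ⟨Γ, Xσ⟩ is an A-based generalization of ⟨∇, t⟩ and ⟨∇, s⟩. -/

import Mathlib

set_option maxHeartbeats 1000000
abbrev Atom := ℕ
abbrev Var := ℕ
abbrev Fn := ℕ
abbrev NPerm := List (Atom × Atom)
def swapAtom (a b c : Atom) : Atom := if c = a then b else if c = b then a else c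
def permAtom : NPerm → Atom → Atom
  | [], c => c
  | (a, b) :: π, c => swapAtom a b (permAtom π c)
def permInv (π : NPerm) : NPerm := π.reverse
inductive NTerm where
  | app : Fn → List NTerm → NTerm
  | atom : Atom → NTerm
  | abs : Atom → NTerm → NTerm
  | susp : NPerm → Var → NTerm

def permTerm (π : NPerm) : NTerm → NTerm
  | .app f ts => .app f (ts.attach.map (fun x => permTerm π x.1))
  | .atom a => .atom (permAtom π a)
  | .abs a t => .abs (permAtom π a) (permTerm π t)
  | .susp ρ X => .susp (π ++ ρ) X
decreasing_by
  all_goals (simp_wf; try omega)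
  all_goals (have := List.sizeOf_lt_of_mem x.2; omega)

/-- Substitutions (total maps from variables to terms; identity almost everywhere
is not required for the statements). -/
abbrev NSubst := Var → NTerm

def idSubst : NSubst := fun X => .susp [] X

/-- Application of a substitution to a term (allowing atom capture and forcing
suspended permutations). -/
def substTerm (σ : NSubst) : NTerm → NTerm
  | .app f ts => .app f (ts.attach.map (fun x => substTerm σ x.1))
  | .atom a => .atom a
  | .abs a t => .abs a (substTerm σ t)
  | .susp π X => permTerm π (σ X)
decreasing_by
  all_goals (simp_wf; try omega)
  all_goals (have := List.sizeOf_lt_of_mem x.2; omega)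

/-- Composition of substitutions: `t (σθ) = (tσ)θ`. -/
def substComp (σ θ : NSubst) : NSubst := fun X => substTerm θ (σ X)

/-- Freshness contexts: finite sets of constraints `a # X`. -/
abbrev FCtx := Finset (Atom × Var)

/-- The freshness relation `Δ ⊢ a # t` (Urban–Pitts–Gabbay rules), stated for an
arbitrary set of freshness constraints. -/
inductive NFresh (Δ : Set (Atom × Var)) : Atom → NTerm → Prop
  | atom {a b : Atom} : a ≠ b → NFresh Δ a (.atom b)
  | susp {a : Atom} {π : NPerm} {X : Var} :
      (permAtom (permInv π) a, X) ∈ Δ → NFresh Δ a (.susp π X)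
  | app {a : Atom} {f : Fn} {ts : List NTerm} :
      (∀ t ∈ ts, NFresh Δ a t) → NFresh Δ a (.app f ts)
  | abs1 {a : Atom} {t : NTerm} : NFresh Δ a (.abs a t)
  | abs2 {a b : Atom} {t : NTerm} : a ≠ b → NFresh Δ a t → NFresh Δ a (.abs b t)

/-- The α-equivalence relation `Δ ⊢ t ≈ s` (Urban–Pitts–Gabbay rules). -/
inductive NAlpha (Δ : Set (Atom × Var)) : NTerm → NTerm → Prop
  | atom (a : Atom) : NAlpha Δ (.atom a) (.atom a)
  | abs1 {a : Atom} {t t' : NTerm} : NAlpha Δ t t' → NAlpha Δ (.abs a t) (.abs a t')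
  | abs2 {a b : Atom} {t t' : NTerm} : a ≠ b → NAlpha Δ t (permTerm [(a, b)] t') →
      NFresh Δ a t' → NAlpha Δ (.abs a t) (.abs b t')
  | susp {π π' : NPerm} {X : Var} :
      (∀ a : Atom, permAtom π a ≠ permAtom π' a → (a, X) ∈ Δ) →
      NAlpha Δ (.susp π X) (.susp π' X)
  | app {f : Fn} {ts ss : List NTerm} : ts.length = ss.length →
      (∀ p ∈ List.zip ts ss, NAlpha Δ p.1 p.2) →
      NAlpha Δ (.app f ts) (.app f ss)

/-- `FA⁻ˢ(t)`: atoms occurring freely in `t`, ignoring suspensions. -/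
def FAnoSusp : NTerm → Finset Atom
  | .app _ ts => (ts.attach.map (fun x => FAnoSusp x.1)).foldr (· ∪ ·) ∅
  | .atom a => {a}
  | .abs a t => FAnoSusp t \ {a}
  | .susp _ _ => ∅
decreasing_by
  all_goals (simp_wf; try omega)
  all_goals (have := List.sizeOf_lt_of_mem x.2; omega)

/-- A substitution respects a freshness context. -/
def Respects (σ : NSubst) (Δ : FCtx) : Prop :=
  ∀ a X, (a, X) ∈ Δ → a ∉ FAnoSusp (σ X)

/-! ### The algorithm FC -/

/-- A finite set of atomic freshness formulas `a # t`. -/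
abbrev FProb := Multiset (Atom × NTerm)

/-- One step of the algorithm FC, transforming pairs `(F; Δ)`. -/
inductive FCStep : FProb × FCtx → FProb × FCtx → Prop
  | del {a b : Atom} {F : FProb} {Δ : FCtx} : a ≠ b →
      FCStep ((a, .atom b) ::ₘ F, Δ) (F, Δ)
  | abs1 {a : Atom} {t : NTerm} {F : FProb} {Δ : FCtx} :
      FCStep ((a, .abs a t) ::ₘ F, Δ) (F, Δ)
  | abs2 {a b : Atom} {t : NTerm} {F : FProb} {Δ : FCtx} : a ≠ b →
      FCStep ((a, .abs b t) ::ₘ F, Δ) ((a, t) ::ₘ F, Δ)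
  | dec {a : Atom} {f : Fn} {ts : List NTerm} {F : FProb} {Δ : FCtx} :
      FCStep ((a, .app f ts) ::ₘ F, Δ) (↑(ts.map (fun t => (a, t))) + F, Δ)
  | sus {a : Atom} {π : NPerm} {X : Var} {F : FProb} {Δ : FCtx} :
      FCStep ((a, .susp π X) ::ₘ F, Δ) (F, insert (permAtom (permInv π) a, X) Δ)

/-- The algorithm FC succeeds on `F` with result `Γ`. -/
def FCReaches (F : FProb) (Γ : FCtx) : Prop :=
  Relation.ReflTransGen FCStep (F, ∅) (0, Γ)

/-- The algorithm FC fails on `F` (reaches a stuck state with remaining formulas). -/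
def FCFails (F : FProb) : Prop :=
  ∃ st : FProb × FCtx, Relation.ReflTransGen FCStep (F, ∅) st ∧ st.1 ≠ 0 ∧
    ∀ st', ¬ FCStep st st'

/-- The freshness problem `{a # Xσ | a#X ∈ Δ}` defining the instance `Δσ`. -/
def ctxSubstProb (Δ : FCtx) (σ : NSubst) : FProb :=
  Δ.val.map (fun c => (c.1, σ c.2))

/-! ### Terms-in-context and the subsumption order -/

/-- A term-in-context. -/
abbrev TIC := FCtx × NTerm

/-- `p ⪯ q`: the term-in-context `p` is more general than `q`.  (The condition
`p.1 σ ⊆ q.1` is expressed, equivalently by the properties of FC, as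
`q.1 ⊢ a # Xσ` for all `a # X ∈ p.1`.) -/
def TIC.Le (p q : TIC) : Prop :=
  ∃ σ : NSubst, Respects σ p.1 ∧
    (∀ c ∈ p.1, NFresh (↑q.1 : Set (Atom × Var)) c.1 (σ c.2)) ∧
    NAlpha (↑q.1 : Set (Atom × Var)) (substTerm σ p.2) q.2

/-- The strict part of `⪯`. -/
def TIC.Lt (p q : TIC) : Prop := TIC.Le p q ∧ ¬ TIC.Le q p

/-- Equi-generality `≃`. -/
def TIC.Equiv (p q : TIC) : Prop := TIC.Le p q ∧ TIC.Le q p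

/-- `r` is a generalization of `p₁` and `p₂`. -/
def IsGen (r p₁ p₂ : TIC) : Prop := TIC.Le r p₁ ∧ TIC.Le r p₂

/-! ### Atoms, variables, basedness -/

def permAtoms : NPerm → Finset Atom
  | [] => ∅
  | (a, b) :: π => insert a (insert b (permAtoms π))

def termAtoms : NTerm → Finset Atom
  | .app _ ts => (ts.attach.map (fun x => termAtoms x.1)).foldr (· ∪ ·) ∅
  | .atom a => {a}
  | .abs a t => insert a (termAtoms t)
  | .susp π _ => permAtoms π
decreasing_by
  all_goals (simp_wf; try omega)
  all_goals (have := List.sizeOf_lt_of_mem x.2; omega)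

def termVars : NTerm → Finset Var
  | .app _ ts => (ts.attach.map (fun x => termVars x.1)).foldr (· ∪ ·) ∅
  | .atom _ => ∅
  | .abs _ t => termVars t
  | .susp _ X => {X}
decreasing_by
  all_goals (simp_wf; try omega)
  all_goals (have := List.sizeOf_lt_of_mem x.2; omega)

/-- `FA(t)`: the atoms occurring freely in `t` (with `FA(π·X) = Atoms(π)`). -/
def termFA : NTerm → Finset Atom
  | .app _ ts => (ts.attach.map (fun x => termFA x.1)).foldr (· ∪ ·) ∅
  | .atom a => {a}
  | .abs a t => termFA t \ {a}
  | .susp π _ => permAtoms π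
decreasing_by
  all_goals (simp_wf; try omega)
  all_goals (have := List.sizeOf_lt_of_mem x.2; omega)

def ctxAtoms (Δ : FCtx) : Finset Atom := Δ.image Prod.fst
def ctxVars (Δ : FCtx) : Finset Var := Δ.image Prod.snd

def permBased (π : NPerm) (A : Finset Atom) : Prop := permAtoms π ⊆ A
def termBased (t : NTerm) (A : Finset Atom) : Prop := termAtoms t ⊆ A
def ctxBased (Δ : FCtx) (A : Finset Atom) : Prop := ctxAtoms Δ ⊆ A
def ticBased (p : TIC) (A : Finset Atom) : Prop := ctxBased p.1 A ∧ termBased p.2 A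

/-- The number of abstraction occurrences in a term. -/
def absCount : NTerm → ℕ
  | .app _ ts => (ts.attach.map (fun x => absCount x.1)).sum
  | .atom _ => 0
  | .abs _ t => absCount t + 1
  | .susp _ _ => 0
decreasing_by
  all_goals (simp_wf; try omega)
  all_goals (have := List.sizeOf_lt_of_mem x.2; omega)

/-! ### The nominal anti-unification algorithm 𝔑 -/

/-- Anti-unification triple `X : t ≜ s`. -/
abbrev AUT := Var × NTerm × NTerm

/-- A state of the algorithm 𝔑: the unsolved triples `P`, the store `S`, the
freshness context `Γ`, the substitution `σ`, and the set `V` of variables used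
so far (needed to express freshness of the generated variables). -/
structure NState where
  P : Multiset AUT
  S : Multiset AUT
  Γ : FCtx
  σ : NSubst
  V : Finset Var

/-- `σ{X ↦ u}`. -/
def updSubst (σ : NSubst) (X : Var) (u : NTerm) : NSubst :=
  substComp σ (fun Z => if Z = X then u else .susp [] Z)

/-- The head of a term (a function symbol together with its arity, an atom, the
abstraction operator, or a variable). -/
inductive NHead where
  | fn : Fn → ℕ → NHead
  | atom : Atom → NHead
  | abs : NHead
  | var : Var → NHead
deriving DecidableEq

def headOf : NTerm → NHead
  | .app f ts => .fn f ts.length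
  | .atom a => .atom a
  | .abs _ _ => .abs
  | .susp _ X => .var X

def IsSusp : NTerm → Prop
  | .susp _ _ => True
  | _ => False

def IsAbs : NTerm → Prop
  | .abs _ _ => True
  | _ => False

/-- The applicability condition of the rule Sol. -/
def SolCond (A : Finset Atom) (Δ : FCtx) (t s : NTerm) : Prop :=
  headOf t ≠ headOf s ∨ (IsSusp t ∧ IsSusp s) ∨
    (IsAbs t ∧ IsAbs s ∧
      ¬ ∃ c ∈ A, NFresh (↑Δ : Set (Atom × Var)) c t ∧ NFresh (↑Δ : Set (Atom × Var)) c s)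

open Classical in
/-- `{a # X | a ∈ A, Δ ⊢ a # t, Δ ⊢ a # s}`. -/
noncomputable def solSet (A : Finset Atom) (Δ : FCtx) (t s : NTerm) (X : Var) : FCtx :=
  (A.filter (fun a =>
    NFresh (↑Δ : Set (Atom × Var)) a t ∧ NFresh (↑Δ : Set (Atom × Var)) a s)).image
    (fun a => (a, X))

/-- `Γ{Y ↦ π·X}` on a freshness context. -/
def ctxRename (Γ : FCtx) (Y : Var) (π : NPerm) (X : Var) : FCtx :=
  Γ.image (fun c => if c.2 = Y then (permAtom (permInv π) c.1, X) else c)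

/-- One step of the algorithm 𝔑, with global parameters `A` and `Δ`. -/
inductive NStep (A : Finset Atom) (Δ : FCtx) : NState → NState → Prop
  | decApp {X : Var} {f : Fn} {ts ss : List NTerm} {P S : Multiset AUT} {Γ : FCtx}
      {σ : NSubst} {V : Finset Var} (Ys : List Var) :
      ts.length = ss.length → Ys.length = ts.length → Ys.Nodup →
      (∀ Y ∈ Ys, Y ∉ V) →
      NStep A Δ ⟨(X, .app f ts, .app f ss) ::ₘ P, S, Γ, σ, V⟩
        ⟨↑(List.zipWith (fun Y p => (Y, p)) Ys (List.zip ts ss)) + P, S, Γ,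
         updSubst σ X (.app f (Ys.map (fun Y => .susp [] Y))), V ∪ Ys.toFinset⟩
  | decAtom {X : Var} {a : Atom} {P S : Multiset AUT} {Γ : FCtx} {σ : NSubst}
      {V : Finset Var} :
      NStep A Δ ⟨(X, .atom a, .atom a) ::ₘ P, S, Γ, σ, V⟩
        ⟨P, S, Γ, updSubst σ X (.atom a), V⟩
  | abs {X : Var} {a b : Atom} {t s : NTerm} {P S : Multiset AUT} {Γ : FCtx}
      {σ : NSubst} {V : Finset Var} (Y : Var) (c : Atom) :
      Y ∉ V → c ∈ A →
      NFresh (↑Δ : Set (Atom × Var)) c (.abs a t) →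
      NFresh (↑Δ : Set (Atom × Var)) c (.abs b s) →
      NStep A Δ ⟨(X, .abs a t, .abs b s) ::ₘ P, S, Γ, σ, V⟩
        ⟨(Y, permTerm [(c, a)] t, permTerm [(c, b)] s) ::ₘ P, S, Γ,
         updSubst σ X (.abs c (.susp [] Y)), insert Y V⟩
  | sol {X : Var} {t s : NTerm} {P S : Multiset AUT} {Γ : FCtx} {σ : NSubst}
      {V : Finset Var} :
      SolCond A Δ t s →
      NStep A Δ ⟨(X, t, s) ::ₘ P, S, Γ, σ, V⟩
        ⟨P, (X, t, s) ::ₘ S, Γ ∪ solSet A Δ t s X, σ, V⟩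
  | mer {X Y : Var} {t₁ s₁ t₂ s₂ : NTerm} {P S : Multiset AUT} {Γ : FCtx}
      {σ : NSubst} {V : Finset Var} (π : NPerm) :
      X ≠ Y →
      permBased π (termAtoms t₁ ∪ termAtoms s₁ ∪ termAtoms t₂ ∪ termAtoms s₂) →
      NAlpha (↑Δ : Set (Atom × Var)) (permTerm π t₁) t₂ →
      NAlpha (↑Δ : Set (Atom × Var)) (permTerm π s₁) s₂ →
      NStep A Δ ⟨P, (X, t₁, s₁) ::ₘ (Y, t₂, s₂) ::ₘ S, Γ, σ, V⟩
        ⟨P, (X, t₁, s₁) ::ₘ S, ctxRename Γ Y π X, updSubst σ Y (.susp π X), V⟩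

/-- The initial state of 𝔑 on the triple `X : t ≜ s`. -/
def initNState (X : Var) (t s : NTerm) (Δ : FCtx) : NState :=
  ⟨{(X, t, s)}, 0, ∅, idSubst, insert X (termVars t ∪ termVars s ∪ ctxVars Δ)⟩

/-- An `A`-based least general generalization of `p₁` and `p₂`. -/
def IsABasedLgg (A : Finset Atom) (p p₁ p₂ : TIC) : Prop :=
  ticBased p A ∧ IsGen p p₁ p₂ ∧
    ¬ ∃ p' : TIC, ticBased p' A ∧ IsGen p' p₁ p₂ ∧ TIC.Lt p p'

/-! ### The equivariance algorithm 𝔈 -/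

/-- A set of equivariance equations `t ≈ s`. -/
abbrev EProb := Multiset (NTerm × NTerm)

def eqsAtoms (E : EProb) : Finset Atom :=
  (E.map (fun e => termAtoms e.1 ∪ termAtoms e.2)).sup

def eqsVars (E : EProb) : Finset Var :=
  (E.map (fun e => termVars e.1 ∪ termVars e.2)).sup

/-- All equations of `E` are equations between atoms. -/
def AtomEqs (E : EProb) : Prop := ∀ e ∈ E, ∃ a b : Atom, e = (NTerm.atom a, NTerm.atom b)

/-- One step of the equivariance algorithm 𝔈 (with fixed freshness context `Δ`) on
states `(E; A; π)`.  The first-phase rules require `π = Id`; the second-phase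
rules require that only equations between atoms are left. -/
inductive EStep (Δ : FCtx) :
    EProb × Finset Atom × NPerm → EProb × Finset Atom × NPerm → Prop
  | dec {f : Fn} {ts ss : List NTerm} {E : EProb} {A : Finset Atom} :
      ts.length = ss.length →
      EStep Δ ((.app f ts, .app f ss) ::ₘ E, A, []) (↑(List.zip ts ss) + E, A, [])
  | alp {a b : Atom} {t s : NTerm} {E : EProb} {A : Finset Atom} (c : Atom) :
      c ∉ A → c ∉ eqsAtoms ((.abs a t, .abs b s) ::ₘ E) → c ∉ ctxAtoms Δ →
      EStep Δ ((.abs a t, .abs b s) ::ₘ E, A, [])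
        ((permTerm [(c, a)] t, permTerm [(c, b)] s) ::ₘ E, A, [])
  | sus {π₁ π₂ : NPerm} {X : Var} {E : EProb} {A : Finset Atom} :
      EStep Δ ((.susp π₁ X, .susp π₂ X) ::ₘ E, A, [])
        (↑((A.filter (fun a => (a, X) ∉ Δ)).toList.map
            (fun a => (NTerm.atom (permAtom π₁ a), NTerm.atom (permAtom π₂ a)))) + E,
         A, [])
  | rem {a b : Atom} {E : EProb} {A : Finset Atom} {π : NPerm} :
      AtomEqs ((.atom a, .atom b) ::ₘ E) → permAtom π a = b →
      EStep Δ ((.atom a, .atom b) ::ₘ E, A, π) (E, A.erase b, π)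
  | sol {a b : Atom} {E : EProb} {A : Finset Atom} {π : NPerm} :
      AtomEqs ((.atom a, .atom b) ::ₘ E) →
      permAtom π a ∈ A → b ∈ A → permAtom π a ≠ b →
      EStep Δ ((.atom a, .atom b) ::ₘ E, A, π) (E, A.erase b, (permAtom π a, b) :: π)

/-! ### Structural induction and unfolding equations -/

theorem NTerm.induct {motive : NTerm → Prop}
    (app : ∀ f ts, (∀ t ∈ ts, motive t) → motive (.app f ts))
    (atom : ∀ a, motive (.atom a))
    (abs : ∀ a t, motive t → motive (.abs a t))
    (susp : ∀ π X, motive (.susp π X)) (t : NTerm) : motive t :=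
  NTerm.rec (motive_1 := motive) (motive_2 := fun ts => ∀ t ∈ ts, motive t)
    app atom abs susp (by simp) (fun _ _ h hs => by simpa using ⟨h, hs⟩) t

theorem permTerm_app (π : NPerm) (f : Fn) (ts : List NTerm) :
    permTerm π (.app f ts) = .app f (ts.map (permTerm π)) := by
  rw [permTerm]; simp

theorem substTerm_app (σ : NSubst) (f : Fn) (ts : List NTerm) :
    substTerm σ (.app f ts) = .app f (ts.map (substTerm σ)) := by
  rw [substTerm]; simp

theorem mem_foldr_union {α : Type*} (g : α → Finset Atom) (ts : List α) (a : Atom) :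
    a ∈ (ts.map g).foldr (· ∪ ·) ∅ ↔ ∃ t ∈ ts, a ∈ g t := by
  induction ts with
  | nil => simp
  | cons t ts ih => simp [ih]

theorem mem_termAtoms_app {a : Atom} {f : Fn} {ts : List NTerm} :
    a ∈ termAtoms (.app f ts) ↔ ∃ t ∈ ts, a ∈ termAtoms t := by
  rw [termAtoms, mem_foldr_union]; simp

theorem mem_FAnoSusp_app {a : Atom} {f : Fn} {ts : List NTerm} :
    a ∈ FAnoSusp (.app f ts) ↔ ∃ t ∈ ts, a ∈ FAnoSusp t := by
  rw [FAnoSusp, mem_foldr_union]; simp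

/-! ### Permutations -/

theorem permAtom_append (π ρ : NPerm) (a : Atom) :
    permAtom (π ++ ρ) a = permAtom π (permAtom ρ a) := by
  induction π with
  | nil => rfl
  | cons p π ih => simp [permAtom, ih]

theorem swapAtom_swapAtom (a b c : Atom) : swapAtom a b (swapAtom a b c) = c := by
  unfold swapAtom; grind

theorem permAtom_permInv (π : NPerm) (a : Atom) : permAtom π (permAtom (permInv π) a) = a := by
  induction π generalizing a with
  | nil => rfl
  | cons p π ih =>
    have h : permInv (p :: π) = permInv π ++ [p] := by simp [permInv]
    rw [h, permAtom_append]
    simp [permAtom, ih, swapAtom_swapAtom]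

theorem permInv_permAtom (π : NPerm) (a : Atom) : permAtom (permInv π) (permAtom π a) = a := by
  simpa [permInv] using permAtom_permInv (permInv π) a

theorem permAtom_injective (π : NPerm) : Function.Injective (permAtom π) :=
  Function.LeftInverse.injective (permInv_permAtom π)

theorem permTerm_nil (t : NTerm) : permTerm [] t = t := by
  induction t using NTerm.induct with
  | app f ts ih => rw [permTerm_app]; congr 1; simpa using List.map_congr_left ih
  | atom a => simp [permTerm, permAtom]
  | abs a t ih => simp [permTerm, permAtom, ih]
  | susp π X => simp [permTerm]

theorem permTerm_permTerm (π ρ : NPerm) (t : NTerm) :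
    permTerm π (permTerm ρ t) = permTerm (π ++ ρ) t := by
  induction t using NTerm.induct with
  | app f ts ih => simpa [permTerm_app] using ih
  | atom a => simp [permTerm, permAtom_append]
  | abs a t ih => simp [permTerm, permAtom_append, ih]
  | susp π X => simp [permTerm]

/-! ### Substitutions -/

theorem substTerm_permTerm (σ : NSubst) (π : NPerm) (t : NTerm) :
    substTerm σ (permTerm π t) = permTerm π (substTerm σ t) := by
  induction t using NTerm.induct with
  | app f ts ih => simpa [permTerm_app, substTerm_app] using ih
  | atom a => simp [permTerm, substTerm]
  | abs a t ih => simp [permTerm, substTerm, ih]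
  | susp π X => simp [permTerm, substTerm, permTerm_permTerm]

theorem substTerm_substTerm (σ θ : NSubst) (t : NTerm) :
    substTerm θ (substTerm σ t) = substTerm (substComp σ θ) t := by
  induction t using NTerm.induct with
  | app f ts ih => simpa [substTerm_app] using ih
  | atom a => simp [substTerm]
  | abs a t ih => simp [substTerm, ih]
  | susp π X => simp [substTerm, substComp, substTerm_permTerm]

/-- The substitution acting as `θ` except that `X` is sent to `uθ`. -/
def preUpd (θ : NSubst) (X : Var) (u : NTerm) : NSubst :=
  fun W => if W = X then substTerm θ u else θ W

theorem substTerm_updSubst (σ θ : NSubst) (X Z : Var) (u : NTerm) :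
    substTerm θ (updSubst σ X u Z) = substTerm (preUpd θ X u) (σ Z) := by
  rw [updSubst, substComp, substTerm_substTerm]
  congr 1
  funext W
  by_cases h : W = X <;> simp [substComp, preUpd, h, substTerm, permTerm_nil]

/-! ### Terms over a finite set of atoms -/

theorem termBased_app {f : Fn} {ts : List NTerm} {A : Finset Atom} :
    termBased (.app f ts) A ↔ ∀ t ∈ ts, termBased t A := by
  simp only [termBased, Finset.subset_iff, mem_termAtoms_app]
  grind

theorem termBased_atom {a : Atom} {A : Finset Atom} : termBased (.atom a) A ↔ a ∈ A := by
  simp [termBased, termAtoms]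

theorem termBased_abs {a : Atom} {t : NTerm} {A : Finset Atom} :
    termBased (.abs a t) A ↔ a ∈ A ∧ termBased t A := by
  simp [termBased, termAtoms, Finset.insert_subset_iff]

theorem termBased_susp {π : NPerm} {X : Var} {A : Finset Atom} :
    termBased (.susp π X) A ↔ permBased π A := by
  simp [termBased, termAtoms, permBased]

theorem permBased_nil (A : Finset Atom) : permBased [] A := by
  simp [permBased, permAtoms]

theorem permBased_cons {a b : Atom} {π : NPerm} {A : Finset Atom} :
    permBased ((a, b) :: π) A ↔ a ∈ A ∧ b ∈ A ∧ permBased π A := by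
  simp [permBased, permAtoms, Finset.insert_subset_iff]

theorem permBased_iff {π : NPerm} {A : Finset Atom} :
    permBased π A ↔ ∀ p ∈ π, p.1 ∈ A ∧ p.2 ∈ A := by
  induction π with
  | nil => simp [permBased_nil]
  | cons p π ih => obtain ⟨a, b⟩ := p; simp [permBased_cons, ih, and_assoc]

theorem permBased.append {π ρ : NPerm} {A : Finset Atom} (hπ : permBased π A)
    (hρ : permBased ρ A) : permBased (π ++ ρ) A := by
  rw [permBased_iff] at *
  grind

theorem permBased.permInv {π : NPerm} {A : Finset Atom} (hπ : permBased π A) :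
    permBased (permInv π) A := by
  rw [permBased_iff] at *
  simpa [_root_.permInv] using hπ

theorem permAtom_mem {π : NPerm} {A : Finset Atom} (hπ : permBased π A) {a : Atom}
    (ha : a ∈ A) : permAtom π a ∈ A := by
  induction π with
  | nil => exact ha
  | cons p π ih =>
    obtain ⟨b, c⟩ := p
    rw [permBased_cons] at hπ
    have := ih hπ.2.2
    simp only [permAtom, swapAtom]
    split_ifs
    · exact hπ.2.1
    · exact hπ.1
    · exact this

theorem termBased.permTerm {t : NTerm} {A : Finset Atom} (ht : termBased t A) {π : NPerm}
    (hπ : permBased π A) : termBased (permTerm π t) A := by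
  induction t using NTerm.induct with
  | app f ts ih =>
    rw [permTerm_app, termBased_app]
    rw [termBased_app] at ht
    simpa using fun t h => ih t h (ht t h)
  | atom a =>
    rw [termBased_atom] at ht
    simpa [_root_.permTerm, termBased_atom] using permAtom_mem hπ ht
  | abs a t ih =>
    rw [termBased_abs] at ht
    simpa [_root_.permTerm, termBased_abs] using ⟨permAtom_mem hπ ht.1, ih ht.2⟩
  | susp ρ X =>
    rw [termBased_susp] at ht
    simpa [_root_.permTerm, termBased_susp] using hπ.append ht

theorem termBased.substTerm {t : NTerm} {A : Finset Atom} (ht : termBased t A) {σ : NSubst}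
    (hσ : ∀ Z, termBased (σ Z) A) : termBased (substTerm σ t) A := by
  induction t using NTerm.induct with
  | app f ts ih =>
    rw [substTerm_app, termBased_app]
    rw [termBased_app] at ht
    simpa using fun t h => ih t h (ht t h)
  | atom a => simpa [_root_.substTerm] using ht
  | abs a t ih =>
    rw [termBased_abs] at ht
    simpa [_root_.substTerm, termBased_abs] using ⟨ht.1, ih ht.2⟩
  | susp ρ X =>
    rw [termBased_susp] at ht
    simpa [_root_.substTerm] using (hσ X).permTerm ht

theorem termBased_updSubst {σ : NSubst} {X Z : Var} {u : NTerm} {A : Finset Atom}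
    (hσ : termBased (σ Z) A) (hu : termBased u A) : termBased (updSubst σ X u Z) A := by
  refine hσ.substTerm fun W => ?_
  split_ifs
  · exact hu
  · exact termBased_susp.2 (permBased_nil A)

/-! ### Freshness -/

theorem NFresh.not_mem_FAnoSusp {Δ : Set (Atom × Var)} {a : Atom} {t : NTerm}
    (h : NFresh Δ a t) : a ∉ FAnoSusp t := by
  induction h with
  | atom h => simpa [FAnoSusp] using h
  | susp h => simp [FAnoSusp]
  | app h ih => rw [mem_FAnoSusp_app]; grind
  | abs1 => simp [FAnoSusp]
  | abs2 h _ ih => simp [FAnoSusp, ih]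

theorem NFresh.of_permTerm {Δ : Set (Atom × Var)} {π : NPerm} {a : Atom} {t : NTerm}
    (h : NFresh Δ (permAtom π a) (permTerm π t)) : NFresh Δ a t := by
  induction t using NTerm.induct generalizing a with
  | app f ts ih =>
    rw [permTerm_app] at h
    cases h with
    | app h => exact .app fun t ht => ih t ht (h _ (List.mem_map_of_mem ht))
  | atom b =>
    simp only [permTerm] at h
    cases h with
    | atom h => exact .atom fun e => h (e ▸ rfl)
  | abs b t ih =>
    simp only [permTerm] at h
    by_cases e : a = b
    · exact e ▸ .abs1
    · generalize hc : permAtom π a = c at h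
      cases h with
      | abs1 => exact absurd (permAtom_injective π hc) e
      | abs2 _ h => exact .abs2 e (ih (hc ▸ h))
  | susp ρ X =>
    simp only [permTerm] at h
    cases h with
    | susp h =>
      have e : permInv (π ++ ρ) = permInv ρ ++ permInv π := by simp [permInv]
      rw [e, permAtom_append, permInv_permAtom] at h
      exact .susp h

/-! ### Nameless representation

`α`-equivalence is characterised as equality of a representation in which bound atoms are
replaced by de Bruijn levels; it is thereby seen to be an equivariant equivalence relation
preserving freshness. -/

/-- Nameless terms; `Sum.inl n` is a binder at level `n`, `Sum.inr a` a free atom. -/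
inductive DTerm where
  | app : Fn → List DTerm → DTerm
  | atom : ℕ ⊕ ℕ → DTerm
  | abs : DTerm → DTerm
  | susp : Var → (Atom → Option (ℕ ⊕ ℕ)) → DTerm

open Classical in
/-- The nameless representation of a term at binding depth `n`, where `e` interprets atoms. -/
noncomputable def nameless (Δ : Set (Atom × Var)) (n : ℕ) (e : Atom → ℕ ⊕ ℕ) : NTerm → DTerm
  | .app f ts => .app f (ts.attach.map (fun x => nameless Δ n e x.1))
  | .atom a => .atom (e a)
  | .abs a t => .abs (nameless Δ (n + 1) (Function.update e a (.inl n)) t)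
  | .susp π X => .susp X (fun a => if (a, X) ∈ Δ then none else some (e (permAtom π a)))
decreasing_by
  all_goals (simp_wf; try omega)
  all_goals (have := List.sizeOf_lt_of_mem x.2; omega)

section Nameless

variable {Δ : Set (Atom × Var)}

theorem nameless_app (n : ℕ) (e : Atom → ℕ ⊕ ℕ) (f : Fn) (ts : List NTerm) :
    nameless Δ n e (.app f ts) = .app f (ts.map (nameless Δ n e)) := by
  rw [nameless]; simp

theorem nameless_permTerm (n : ℕ) (e : Atom → ℕ ⊕ ℕ) (π : NPerm) (t : NTerm) :
    nameless Δ n e (permTerm π t) = nameless Δ n (e ∘ permAtom π) t := by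
  induction t using NTerm.induct generalizing n e with
  | app f ts ih => simpa [permTerm_app, nameless_app] using fun t ht => ih t ht n e
  | atom a => simp [permTerm, nameless]
  | abs a t ih =>
    simp only [permTerm, nameless, ih]
    rw [Function.update_comp_eq_of_injective _ (permAtom_injective π)]
  | susp ρ X => simp [permTerm, nameless, permAtom_append]

theorem nameless_congr {n : ℕ} {e e' : Atom → ℕ ⊕ ℕ} {t : NTerm}
    (h : ∀ a, ¬ NFresh Δ a t → e a = e' a) : nameless Δ n e t = nameless Δ n e' t := by
  induction t using NTerm.induct generalizing n e e' with
  | app f ts ih =>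
    rw [nameless_app, nameless_app]
    congr 1
    refine List.map_congr_left fun t ht => ih t ht fun a ha => h a fun hf => ha ?_
    cases hf with
    | app hf => exact hf t ht
  | atom a =>
    simp only [nameless]
    rw [h a]
    rintro ⟨h⟩
    exact h rfl
  | abs b t ih =>
    simp only [nameless]
    congr 1
    refine ih fun a ha => ?_
    by_cases hab : a = b
    · simp [hab]
    · simp only [Function.update_of_ne hab]
      refine h a fun hf => ha ?_
      cases hf with
      | abs1 => exact absurd rfl hab
      | abs2 _ hf => exact hf
  | susp π X =>
    simp only [nameless]
    congr 1
    funext a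
    split_ifs with ha
    · rfl
    · rw [h]
      intro hf
      cases hf with
      | susp hf => exact ha (by rwa [permInv_permAtom] at hf)

theorem NFresh.of_nameless_eq {n : ℕ} {e e' : Atom → ℕ ⊕ ℕ} {t s : NTerm} {a : Atom}
    (h : nameless Δ n e t = nameless Δ n e' s) (hn : ∀ m, n ≤ m → e' a ≠ .inl m)
    (ha : ∀ b, e b ≠ e' a) : NFresh Δ a s := by
  induction s using NTerm.induct generalizing n e e' t with
  | app f ts ih =>
    cases t with
    | app g us =>
      rw [nameless_app, nameless_app] at h
      injection h with _ h
      refine .app fun s hs => ?_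
      have : nameless Δ n e' s ∈ us.map (nameless Δ n e) := h ▸ List.mem_map_of_mem hs
      obtain ⟨u, -, hu⟩ := List.mem_map.1 this
      exact ih s hs hu hn ha
    | _ => simp [nameless] at h
  | atom b =>
    cases t with
    | atom c =>
      simp only [nameless, DTerm.atom.injEq] at h
      exact .atom fun hab => ha c (hab ▸ h)
    | _ => simp [nameless] at h
  | abs b s ih =>
    cases t with
    | abs c t =>
      simp only [nameless, DTerm.abs.injEq] at h
      by_cases hab : a = b
      · exact hab ▸ .abs1
      · refine .abs2 hab (ih h ?_ ?_)
        · intro m hm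
          rw [Function.update_of_ne hab]
          exact hn m (by omega)
        · intro d
          rw [Function.update_of_ne hab]
          by_cases hd : d = c
          · subst hd
            simpa using (hn n le_rfl).symm
          · rw [Function.update_of_ne hd]
            exact ha d
    | _ => simp [nameless] at h
  | susp π X =>
    cases t with
    | susp ρ Y =>
      simp only [nameless, DTerm.susp.injEq] at h
      obtain ⟨rfl, h⟩ := h
      refine .susp ?_
      by_contra hX
      have := congrFun h (permAtom (permInv π) a)
      simp only [hX, if_false, permAtom_permInv, Option.some.injEq] at this
      exact ha _ this
    | _ => simp [nameless] at h

theorem NAlpha.nameless_eq {t s : NTerm} (h : NAlpha Δ t s) (n : ℕ) (e : Atom → ℕ ⊕ ℕ) :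
    nameless Δ n e t = nameless Δ n e s := by
  induction h generalizing n e with
  | atom a => rfl
  | abs1 _ ih => simp only [nameless, ih]
  | @abs2 a b t s hab _ hf ih =>
    simp only [nameless, ih, nameless_permTerm]
    congr 1
    refine nameless_congr fun c hc => ?_
    have hca : c ≠ a := fun h => hc (h ▸ hf)
    simp only [Function.comp, permAtom, swapAtom, hca, if_false]
    split_ifs with hcb
    · simp [hcb]
    · simp [hca, hcb]
  | susp h =>
    simp only [nameless]
    congr 1
    funext a
    split_ifs with ha
    · rfl
    · by_contra hne
      exact ha (h a fun e => hne (by rw [e]))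
  | @app f ts ss hl _ ih =>
    rw [nameless_app, nameless_app]
    congr 1
    refine List.ext_getElem (by simpa using hl) fun i h₁ h₂ => ?_
    simp only [List.length_map] at h₁ h₂
    simpa using ih (ts[i], ss[i]) (List.mem_iff_getElem.2 ⟨i, by simp [h₁, h₂], by simp⟩) n e

theorem NAlpha.of_nameless_eq {n : ℕ} {e : Atom → ℕ ⊕ ℕ} {t s : NTerm}
    (he : Function.Injective e) (hn : ∀ a m, n ≤ m → e a ≠ .inl m)
    (h : nameless Δ n e t = nameless Δ n e s) : NAlpha Δ t s := by
  induction t using NTerm.induct generalizing n e s with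
  | app f ts ih =>
    cases s with
    | app g ss =>
      rw [nameless_app, nameless_app] at h
      injection h with hf h
      subst hf
      have hl : ts.length = ss.length := by simpa using congrArg List.length h
      refine .app hl fun p hp => ?_
      obtain ⟨i, hi, rfl⟩ := List.mem_iff_getElem.1 hp
      simp only [List.length_zip, lt_inf_iff] at hi
      simp only [List.getElem_zip]
      refine ih _ (List.getElem_mem hi.1) he hn ?_
      have h₁ := List.getElem_map (nameless Δ n e) (l := ts) (i := i) (h := by simpa using hi.1)
      have h₂ := List.getElem_map (nameless Δ n e) (l := ss) (i := i) (h := by simpa using hi.2)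
      rw [← h₁, ← h₂]
      simp only [h]
    | _ => simp [nameless] at h
  | atom a =>
    cases s with
    | atom b =>
      simp only [nameless, DTerm.atom.injEq] at h
      exact he h ▸ .atom a
    | _ => simp [nameless] at h
  | abs a t ih =>
    cases s with
    | abs b s =>
      simp only [nameless, DTerm.abs.injEq] at h
      have he' : Function.Injective (Function.update e a (.inl n)) := by
        intro x y hxy
        have := hn x n le_rfl
        have := hn y n le_rfl
        simp only [Function.update_apply] at hxy
        split_ifs at hxy <;> grind
      have hn' : ∀ c m, n + 1 ≤ m → Function.update e a (.inl n) c ≠ .inl m := by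
        intro c m hm
        rw [Function.update_apply]
        split_ifs
        · simp only [ne_eq, Sum.inl.injEq]; omega
        · exact hn c m (by omega)
      by_cases hab : a = b
      · subst hab
        exact .abs1 (ih he' hn' h)
      · have hf : NFresh Δ a s := by
          refine .of_nameless_eq h ?_ ?_
          · intro m hm
            rw [Function.update_of_ne hab]
            exact hn a m (by omega)
          · intro c
            rw [Function.update_of_ne hab, Function.update_apply]
            split_ifs with hc
            · exact (hn a n le_rfl).symm
            · exact fun h => hc (he h)
        refine .abs2 hab (ih he' hn' ?_) hf
        rw [h, nameless_permTerm]
        refine nameless_congr fun c hc => ?_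
        have hca : c ≠ a := fun h => hc (h ▸ hf)
        simp only [Function.comp, permAtom, swapAtom, hca, if_false]
        split_ifs with hcb
        · simp [hcb]
        · simp [hca, hcb]
    | _ => simp [nameless] at h
  | susp π X =>
    cases s with
    | susp ρ Y =>
      simp only [nameless, DTerm.susp.injEq] at h
      obtain ⟨rfl, h⟩ := h
      refine .susp fun a ha => ?_
      by_contra hX
      have := congrFun h a
      simp only [hX, if_false, Option.some.injEq] at this
      exact ha (he this)
    | _ => simp [nameless] at h

theorem nAlpha_iff_nameless_eq {t s : NTerm} :
    NAlpha Δ t s ↔ ∀ n e, nameless Δ n e t = nameless Δ n e s :=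
  ⟨NAlpha.nameless_eq, fun h =>
    .of_nameless_eq (n := 0) (e := .inr) Sum.inr_injective (by simp) (h _ _)⟩

theorem NAlpha.refl (t : NTerm) : NAlpha Δ t t :=
  nAlpha_iff_nameless_eq.2 fun _ _ => rfl

theorem NAlpha.symm {t s : NTerm} (h : NAlpha Δ t s) : NAlpha Δ s t :=
  nAlpha_iff_nameless_eq.2 fun n e => (h.nameless_eq n e).symm

theorem NAlpha.trans {t s u : NTerm} (h : NAlpha Δ t s) (h' : NAlpha Δ s u) : NAlpha Δ t u :=
  nAlpha_iff_nameless_eq.2 fun n e => (h.nameless_eq n e).trans (h'.nameless_eq n e)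

theorem NAlpha.permTerm {t s : NTerm} (h : NAlpha Δ t s) (π : NPerm) :
    NAlpha Δ (permTerm π t) (permTerm π s) :=
  nAlpha_iff_nameless_eq.2 fun n e => by
    simp only [nameless_permTerm, h.nameless_eq]

theorem nAlpha_permTerm_swap_self (a : Atom) (t : NTerm) :
    NAlpha Δ (permTerm [(a, a)] t) t :=
  nAlpha_iff_nameless_eq.2 fun n e => by
    rw [nameless_permTerm]
    congr 1
    funext b
    simp only [Function.comp, permAtom, swapAtom]
    split_ifs <;> simp_all

theorem NFresh.of_nAlpha {a : Atom} {t s : NTerm} (hf : NFresh Δ a t) (h : NAlpha Δ t s) :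
    NFresh Δ a s := by
  let e : Atom → ℕ ⊕ ℕ := fun x => .inr (x + 1)
  refine .of_nameless_eq (n := 0) (e := e) (e' := Function.update e a (.inr 0)) (t := t)
    ?_ (by simp) (by simp [e])
  rw [← h.nameless_eq]
  refine nameless_congr fun b hb => ?_
  rw [Function.update_of_ne]
  rintro rfl
  exact hb hf

theorem NAlpha.abs_swap {a c : Atom} {t u : NTerm} (h : NAlpha Δ u (_root_.permTerm [(c, a)] t))
    (hc : NFresh Δ c (.abs a t)) : NAlpha Δ (.abs c u) (.abs a t) := by
  by_cases hca : c = a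
  · subst hca
    exact .abs1 (h.trans (nAlpha_permTerm_swap_self c t))
  · cases hc with
    | abs1 => exact absurd rfl hca
    | abs2 _ hc => exact .abs2 hca h hc

end Nameless

/-! ### The invariant of the algorithm -/

/-- `θ` sends every variable of `L` to the side `p` of its triple, up to `α`-equivalence. -/
def Solves (Δ : FCtx) (p : NTerm × NTerm → NTerm) (L : Multiset AUT) (θ : NSubst) : Prop :=
  ∀ x ∈ L, NAlpha (↑Δ : Set (Atom × Var)) (θ x.1) (p x.2)

theorem Solves.preUpd {Δ : FCtx} {p : NTerm × NTerm → NTerm} {L : Multiset AUT} {θ : NSubst}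
    {x : AUT} {u : NTerm} (h : Solves Δ p L θ) (hx : ∀ y ∈ L, y.1 ≠ x.1)
    (hu : NAlpha (↑Δ : Set (Atom × Var)) (substTerm θ u) (p x.2)) :
    Solves Δ p (x ::ₘ L) (preUpd θ x.1 u) := by
  intro y hy
  rcases Multiset.mem_cons.1 hy with rfl | hy
  · simpa [_root_.preUpd] using hu
  · simpa [_root_.preUpd, hx y hy] using h y hy

/-- Every instance of `Xσ` solving the triples of `st` is `t` up to `α`-equivalence. -/
def Recovers (Δ : FCtx) (X : Var) (p : NTerm × NTerm → NTerm) (t : NTerm) (st : NState) : Prop :=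
  ∀ θ, Solves Δ p (st.P + st.S) θ → NAlpha (↑Δ : Set (Atom × Var)) (substTerm θ (st.σ X)) t

structure NInv (A : Finset Atom) (Δ : FCtx) (X : Var) (st : NState) : Prop where
  nodup : ((st.P + st.S).map Prod.fst).Nodup
  mem_V : ∀ x ∈ st.P + st.S, x.1 ∈ st.V
  based : ∀ x ∈ st.P + st.S, termBased x.2.1 A ∧ termBased x.2.2 A
  ctx : ctxBased st.Γ A
  subst : termBased (st.σ X) A
  fresh : ∀ c ∈ st.Γ, ∃ x ∈ st.S, x.1 = c.2 ∧ NFresh (↑Δ : Set (Atom × Var)) c.1 x.2.1 ∧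
    NFresh (↑Δ : Set (Atom × Var)) c.1 x.2.2

section Steps

variable {A : Finset Atom} {Δ : FCtx} {X : Var}

theorem ne_of_nodup_cons {x : AUT} {L : Multiset AUT}
    (h : ((x ::ₘ L).map Prod.fst).Nodup) : ∀ y ∈ L, y.1 ≠ x.1 := by
  intro y hy e
  rw [Multiset.map_cons, Multiset.nodup_cons] at h
  exact h.1 (e ▸ Multiset.mem_map_of_mem _ hy)

theorem eq_of_nodup {x y : AUT} {L : Multiset AUT} (h : (L.map Prod.fst).Nodup)
    (hx : x ∈ L) (hy : y ∈ L) (e : x.1 = y.1) : x = y :=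
  Multiset.inj_on_of_nodup_map h x hx y hy e

theorem map_fst_zipWith_mk {ts : List (NTerm × NTerm)} {Ys : List Var}
    (h : Ys.length = ts.length) :
    (List.zipWith (fun Y p => ((Y, p) : AUT)) Ys ts).map Prod.fst = Ys :=
  List.map_fst_zip (l₁ := Ys) (l₂ := ts) h.le

theorem NAlpha.app_of_zipWith {Δ : Set (Atom × Var)} {f : Fn} {ts : List NTerm} {Ys : List Var}
    {θ : NSubst} (hl : Ys.length = ts.length)
    (h : ∀ i (h₁ : i < Ys.length) (h₂ : i < ts.length), NAlpha Δ (θ Ys[i]) ts[i]) :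
    NAlpha Δ (substTerm θ (.app f (Ys.map (fun Y => .susp [] Y)))) (.app f ts) := by
  rw [substTerm_app, List.map_map]
  refine .app (by simpa using hl) fun p hp => ?_
  obtain ⟨i, hi, rfl⟩ := List.mem_iff_getElem.1 hp
  simp only [List.length_zip, List.length_map, lt_inf_iff] at hi
  simpa [substTerm, permTerm_nil] using h i hi.1 hi.2

theorem Recovers.step {p : NTerm × NTerm → NTerm} (hp : p = Prod.fst ∨ p = Prod.snd)
    {t : NTerm} {st st' : NState} (hst : NStep A Δ st st') (hinv : NInv A Δ X st)
    (h : Recovers Δ X p t st) : Recovers Δ X p t st' := by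
  intro θ hθ
  cases hst with
  | @decApp Z f ts ss P S Γ σ V Ys hl hY hnd hV =>
    rw [substTerm_updSubst]
    refine h _ ?_
    have hnodup := hinv.nodup
    simp only [Multiset.cons_add] at hnodup ⊢
    refine Solves.preUpd (x := (Z, .app f ts, .app f ss)) (fun y hy => hθ y ?_)
      (ne_of_nodup_cons hnodup) ?_
    · simp only [Multiset.mem_add] at hy ⊢; tauto
    · have key : ∀ i (h₁ : i < Ys.length) (h₂ : i < ts.length) (h₃ : i < ss.length),
          NAlpha (↑Δ : Set (Atom × Var)) (θ Ys[i]) (p (ts[i], ss[i])) := by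
        intro i h₁ h₂ h₃
        refine hθ (Ys[i], ts[i], ss[i]) ?_
        simp only [Multiset.mem_add, Multiset.mem_coe]
        exact .inl (.inl (List.mem_iff_getElem.2 ⟨i, by simp [h₁, h₂, h₃], by simp⟩))
      rcases hp with rfl | rfl
      · exact .app_of_zipWith hY fun i h₁ h₂ => key i h₁ h₂ (hl ▸ h₂)
      · exact .app_of_zipWith (hY.trans hl) fun i h₁ h₂ => key i h₁ (hl ▸ h₂) h₂
  | @decAtom Z a P S Γ σ V =>
    rw [substTerm_updSubst]
    refine h _ ?_
    have hnodup := hinv.nodup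
    simp only [Multiset.cons_add] at hnodup ⊢
    refine Solves.preUpd (x := (Z, .atom a, .atom a)) hθ (ne_of_nodup_cons hnodup) ?_
    rcases hp with rfl | rfl <;> simpa [substTerm] using NAlpha.atom a
  | @abs Z a b t s P S Γ σ V Y c hY hc ha hb =>
    rw [substTerm_updSubst]
    refine h _ ?_
    have hnodup := hinv.nodup
    simp only [Multiset.cons_add] at hnodup ⊢
    refine Solves.preUpd (x := (Z, .abs a t, .abs b s)) (fun y hy => hθ y ?_)
      (ne_of_nodup_cons hnodup) ?_
    · simp only [Multiset.cons_add, Multiset.mem_cons]; tauto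
    · have := hθ (Y, permTerm [(c, a)] t, permTerm [(c, b)] s) (by simp)
      rcases hp with rfl | rfl
      · simpa [substTerm, permTerm_nil] using this.abs_swap ha
      · simpa [substTerm, permTerm_nil] using this.abs_swap hb
  | @sol Z t s P S Γ σ V hc =>
    refine h θ ?_
    simpa only [Multiset.cons_add, Multiset.add_cons] using hθ
  | @mer Z Y t₁ s₁ t₂ s₂ P S Γ σ V π hne hπ ht hs =>
    rw [substTerm_updSubst]
    refine h _ ?_
    have hnodup := hinv.nodup
    simp only [Multiset.add_cons] at hnodup hθ ⊢
    rw [Multiset.cons_swap] at hnodup ⊢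
    refine Solves.preUpd (x := (Y, t₂, s₂)) hθ (ne_of_nodup_cons hnodup) ?_
    have := (hθ (Z, t₁, s₁) (by simp)).permTerm π
    rcases hp with rfl | rfl
    · simpa [substTerm] using this.trans ht
    · simpa [substTerm] using this.trans hs

theorem NInv.step {st st' : NState} (hst : NStep A Δ st st') (h : NInv A Δ X st) :
    NInv A Δ X st' := by
  obtain ⟨hnodup, hV, hb, hctx, hsub, hfr⟩ := h
  cases hst with
  | @decApp Z f ts ss P S Γ σ V Ys hl hY hnd hYV =>
    have hlz : Ys.length = (List.zip ts ss).length := by simp [← hl, hY]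
    simp only [Multiset.cons_add, Multiset.mem_cons, forall_eq_or_imp, termBased_app] at *
    have hfst : ∀ x ∈ List.zipWith (fun Y p => ((Y, p) : AUT)) Ys (List.zip ts ss), x.1 ∈ Ys := by
      intro x hx
      have := List.mem_map_of_mem (f := Prod.fst) hx
      rwa [map_fst_zipWith_mk hlz] at this
    refine ⟨?_, ?_, ?_, hctx, ?_, hfr⟩
    · rw [add_assoc, Multiset.map_add, Multiset.map_coe, map_fst_zipWith_mk hlz,
        Multiset.nodup_add]
      refine ⟨Multiset.coe_nodup.2 hnd, ?_, ?_⟩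
      · rw [Multiset.map_cons, Multiset.nodup_cons] at hnodup
        exact hnodup.2
      · rw [Multiset.disjoint_left]
        intro Y hY' hmem
        obtain ⟨x, hx, rfl⟩ := Multiset.mem_map.1 hmem
        exact hYV _ (Multiset.mem_coe.1 hY') (hV.2 x hx)
    · intro x hx
      rw [add_assoc, Multiset.mem_add, Multiset.mem_coe] at hx
      rcases hx with hx | hx
      · exact Finset.mem_union_right _ (List.mem_toFinset.2 (hfst x hx))
      · exact Finset.mem_union_left _ (hV.2 x hx)
    · intro x hx
      rw [add_assoc, Multiset.mem_add, Multiset.mem_coe] at hx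
      rcases hx with hx | hx
      · obtain ⟨i, hi, rfl⟩ := List.mem_iff_getElem.1 hx
        simp only [List.getElem_zipWith, List.getElem_zip]
        exact ⟨hb.1.1 _ (List.getElem_mem _), hb.1.2 _ (List.getElem_mem _)⟩
      · exact hb.2 x hx
    · refine termBased_updSubst hsub (termBased_app.2 fun u hu => ?_)
      obtain ⟨Y, -, rfl⟩ := List.mem_map.1 hu
      exact termBased_susp.2 (permBased_nil A)
  | @decAtom Z a P S Γ σ V =>
    simp only [Multiset.cons_add, Multiset.mem_cons, forall_eq_or_imp] at *
    rw [Multiset.map_cons, Multiset.nodup_cons] at hnodup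
    exact ⟨hnodup.2, hV.2, hb.2, hctx, termBased_updSubst hsub hb.1.1, hfr⟩
  | @abs Z a b t s P S Γ σ V Y c hY hc ha hbf =>
    simp only [Multiset.cons_add, Multiset.mem_cons, forall_eq_or_imp, termBased_abs] at *
    rw [Multiset.map_cons, Multiset.nodup_cons] at hnodup
    refine ⟨?_, ?_, ?_, hctx, ?_, hfr⟩
    · simp only [Multiset.cons_add]
      rw [Multiset.map_cons, Multiset.nodup_cons]
      refine ⟨fun hmem => ?_, hnodup.2⟩
      obtain ⟨x, hx, rfl⟩ := Multiset.mem_map.1 hmem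
      exact hY (hV.2 x hx)
    · simp only [Multiset.cons_add, Multiset.mem_cons, forall_eq_or_imp]
      exact ⟨Finset.mem_insert_self _ _, fun x hx => Finset.mem_insert_of_mem (hV.2 x hx)⟩
    · simp only [Multiset.cons_add, Multiset.mem_cons, forall_eq_or_imp]
      have hswap : ∀ d ∈ A, permBased [(c, d)] A := fun d hd =>
        permBased_cons.2 ⟨hc, hd, permBased_nil A⟩
      exact ⟨⟨hb.1.1.2.permTerm (hswap a hb.1.1.1), hb.1.2.2.permTerm (hswap b hb.1.2.1)⟩, hb.2⟩
    · exact termBased_updSubst hsub (termBased_abs.2 ⟨hc, termBased_susp.2 (permBased_nil A)⟩)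
  | @sol Z t s P S Γ σ V hc =>
    simp only [Multiset.cons_add] at hnodup hV hb
    refine ⟨by simpa only [Multiset.add_cons] using hnodup,
      by simpa only [Multiset.add_cons] using hV, by simpa only [Multiset.add_cons] using hb,
      ?_, hsub, ?_⟩
    · simp only [ctxBased, ctxAtoms, Finset.image_union, Finset.union_subset_iff]
      refine ⟨hctx, fun a ha => ?_⟩
      simp only [solSet, Finset.mem_image, Finset.mem_filter] at ha
      obtain ⟨_, ⟨d, ⟨hd, -⟩, rfl⟩, rfl⟩ := ha
      exact hd
    · intro d hd
      rcases Finset.mem_union.1 hd with hd | hd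
      · obtain ⟨x, hx, hx'⟩ := hfr d hd
        exact ⟨x, Multiset.mem_cons_of_mem hx, hx'⟩
      · simp only [solSet, Finset.mem_image, Finset.mem_filter] at hd
        obtain ⟨e, ⟨-, he⟩, rfl⟩ := hd
        exact ⟨_, Multiset.mem_cons_self _ _, rfl, he⟩
  | @mer Z Y t₁ s₁ t₂ s₂ P S Γ σ V π hne hπ ht hs =>
    have hle : P + (Z, t₁, s₁) ::ₘ S ≤ P + (Z, t₁, s₁) ::ₘ (Y, t₂, s₂) ::ₘ S := by
      rw [Multiset.cons_swap]
      exact add_le_add_right (Multiset.le_cons_self _ _) P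
    have hsubset := Multiset.subset_of_le hle
    have hb₁ := hb (Z, t₁, s₁) (by simp)
    have hb₂ := hb (Y, t₂, s₂) (by simp)
    have hπA : permBased π A := by
      refine hπ.trans ?_
      simp only [Finset.union_subset_iff]
      exact ⟨⟨⟨hb₁.1, hb₁.2⟩, hb₂.1⟩, hb₂.2⟩
    refine ⟨Multiset.nodup_of_le (Multiset.map_le_map hle) hnodup,
      fun x hx => hV x (hsubset hx), fun x hx => hb x (hsubset hx), ?_,
      termBased_updSubst hsub (termBased_susp.2 hπA), ?_⟩
    · intro a ha
      simp only [ctxAtoms, ctxRename, Finset.mem_image] at ha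
      obtain ⟨_, ⟨c, hc, rfl⟩, rfl⟩ := ha
      have hcA : c.1 ∈ A := hctx (Finset.mem_image_of_mem _ hc)
      split_ifs
      · exact permAtom_mem hπA.permInv hcA
      · exact hcA
    · intro d hd
      simp only [ctxRename, Finset.mem_image] at hd
      obtain ⟨c, hc, rfl⟩ := hd
      obtain ⟨x, hx, hxc, hf⟩ := hfr c hc
      split_ifs with hcY
      · have hxY : x = (Y, t₂, s₂) :=
          eq_of_nodup hnodup (Multiset.mem_add.2 (.inr hx)) (by simp) (hxc.trans hcY)
        subst hxY
        refine ⟨_, Multiset.mem_cons_self _ _, rfl, .of_permTerm (π := π) ?_,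
          .of_permTerm (π := π) ?_⟩
        · rw [permAtom_permInv]
          exact hf.1.of_nAlpha ht.symm
        · rw [permAtom_permInv]
          exact hf.2.of_nAlpha hs.symm
      · refine ⟨x, ?_, hxc, hf⟩
        simp only [Multiset.mem_cons] at hx ⊢
        rcases hx with hx | rfl | hx
        · exact .inl hx
        · exact absurd hxc.symm hcY
        · exact .inr hx

theorem NInv.init {t s : NTerm} (ht : termBased t A) (hs : termBased s A) :
    NInv A Δ X (initNState X t s Δ) := by
  refine ⟨?_, ?_, ?_, ?_, ?_, ?_⟩ <;> simp [initNState, ctxBased, ctxAtoms, idSubst, ht, hs,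
    termBased_susp, permBased_nil]

theorem Recovers.init {t s : NTerm} (p : NTerm × NTerm → NTerm) :
    Recovers Δ X p (p (t, s)) (initNState X t s Δ) := by
  intro θ hθ
  simpa [initNState, idSubst, substTerm, permTerm_nil] using hθ (X, t, s) (by simp [initNState])

open Classical in
/-- The substitution sending each variable of `S` to the side `p` of its triple. -/
noncomputable def sideSubst (p : NTerm × NTerm → NTerm) (S : Multiset AUT) : NSubst :=
  fun Y => if h : ∃ x ∈ S, x.1 = Y then p h.choose.2 else .susp [] Y

theorem sideSubst_eq {p : NTerm × NTerm → NTerm} {S : Multiset AUT}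
    (hS : (S.map Prod.fst).Nodup) {x : AUT} (hx : x ∈ S) : sideSubst p S x.1 = p x.2 := by
  have h : ∃ y ∈ S, y.1 = x.1 := ⟨x, hx, rfl⟩
  rw [sideSubst, dif_pos h, eq_of_nodup hS h.choose_spec.1 hx h.choose_spec.2]

theorem NInv.le {p : NTerm × NTerm → NTerm} (hp : p = Prod.fst ∨ p = Prod.snd) {t : NTerm}
    {st : NState} (h : NInv A Δ X st) (hr : Recovers Δ X p t st) (hP : st.P = 0) :
    TIC.Le (st.Γ, st.σ X) (Δ, t) := by
  have hS : (st.S.map Prod.fst).Nodup := by simpa [hP] using h.nodup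
  have hfresh : ∀ c ∈ st.Γ, NFresh (↑Δ : Set (Atom × Var)) c.1 (sideSubst p st.S c.2) := by
    intro c hc
    obtain ⟨x, hx, hxc, hf⟩ := h.fresh c hc
    rw [← hxc, sideSubst_eq hS hx]
    rcases hp with rfl | rfl
    · exact hf.1
    · exact hf.2
  refine ⟨sideSubst p st.S, fun a Y hc => (hfresh (a, Y) hc).not_mem_FAnoSusp, hfresh,
    hr _ fun x hx => ?_⟩
  rw [hP, zero_add] at hx
  rw [sideSubst_eq hS hx]
  exact .refl _

end Steps

/-- soundness of the nominal anti-unification algorithm 𝔑: every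
derivation starting from `{X : t ≜ s}; ∅; ∅; ε` and ending with an empty set
of unsolved triples computes an `A`-based generalization `⟨Γ, Xσ⟩` of `⟨Δ, t⟩`
and `⟨Δ, s⟩`. -/
theorem nau_soundness (A : Finset Atom) (Δ : FCtx) (t s : NTerm) (X : Var)
    (ht : termBased t A) (hs : termBased s A) (hΔ : ctxBased Δ A)
    (S : Multiset AUT) (Γ : FCtx) (σ : NSubst) (V : Finset Var)
    (hderiv : Relation.TransGen (NStep A Δ) (initNState X t s Δ) ⟨0, S, Γ, σ, V⟩) :
    ticBased (Γ, σ X) A ∧ IsGen (Γ, σ X) (Δ, t) (Δ, s) := by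
  have key : ∀ st, Relation.ReflTransGen (NStep A Δ) (initNState X t s Δ) st →
      NInv A Δ X st ∧ Recovers Δ X Prod.fst t st ∧ Recovers Δ X Prod.snd s st := by
    intro st hst
    induction hst with
    | refl => exact ⟨.init ht hs, .init Prod.fst, .init Prod.snd⟩
    | tail _ hstep ih =>
      exact ⟨ih.1.step hstep, ih.2.1.step (.inl rfl) hstep ih.1, ih.2.2.step (.inr rfl) hstep ih.1⟩
  obtain ⟨hinv, hfst, hsnd⟩ := key _ hderiv.to_reflTransGen
  exact ⟨⟨hinv.ctx, hinv.subst⟩, hinv.le (.inl rfl) hfst rfl, hinv.le (.inr rfl) hsnd rfl⟩
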